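/- arXiv:2307.01034 — 4 statements merged into one kernel-verified Lean document; each statement's English description precedes it below -/
import Mathlib

section
/- Assume −c̄ ∈ cone{a_t : t ∈ T}. Then: (i) for every b ∈ ℝ^m, F_c̄^op(b) = ⋃_{D ∈ M_c̄} S_D(b); (ii) for every D ∈ M_c̄ and every b ∈ dom S_D, F_c̄^op(b) = S_D(b). Consequently, F_c̄^op = ⋃_{D ∈ M_c̄} S_D is a well-connected polyhedral mapping (with index set M_c̄). -/
open scoped ENNReal RealInnerProductSpace
open Filter EMetric Set

/-- The feasible set mapping `F(b) = {x ∈ ℝⁿ : ⟨a_t, x⟩ ≤ b_t for all t ∈ T}`. -/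
def Feas {n m : ℕ} (a : Fin m → EuclideanSpace ℝ (Fin n)) (b : Fin m → ℝ) :
    Set (EuclideanSpace ℝ (Fin n)) :=
  {x | ∀ t, ⟪a t, x⟫ ≤ b t}

/-- The optimal set (argmin) mapping `F^op(c,b) = argmin{⟨c,x⟩ : x ∈ F(b)}`. -/
def Fop {n m : ℕ} (a : Fin m → EuclideanSpace ℝ (Fin n)) (c : EuclideanSpace ℝ (Fin n))
    (b : Fin m → ℝ) : Set (EuclideanSpace ℝ (Fin n)) :=
  {x | x ∈ Feas a b ∧ ∀ y ∈ Feas a b, ⟪c, x⟫ ≤ ⟪c, y⟫}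

/-- Active index set `T_b(x) = {t ∈ T : ⟨a_t, x⟩ = b_t}`. -/
def activeSet {n m : ℕ} (a : Fin m → EuclideanSpace ℝ (Fin n)) (b : Fin m → ℝ)
    (x : EuclideanSpace ℝ (Fin n)) : Set (Fin m) :=
  {t | ⟪a t, x⟫ = b t}

/-- `z ∈ cone{a_t : t ∈ D}` (conical convex hull). -/
def InCone {n m : ℕ} (a : Fin m → EuclideanSpace ℝ (Fin n)) (D : Finset (Fin m))
    (z : EuclideanSpace ℝ (Fin n)) : Prop :=
  ∃ lam : Fin m → ℝ, (∀ t, 0 ≤ lam t) ∧ (∀ t ∉ D, lam t = 0) ∧ z = ∑ t, lam t • a t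

/-- The family of minimal KKT index subsets `M_{c,b}`: all `D ⊆ T_b(x)` (for an optimal
point `x ∈ F^op(c,b)`; independent of the choice of `x`) with `−c ∈ cone{a_t : t ∈ D}`,
minimal with respect to inclusion among such subsets. (It is empty when `F^op(c,b) = ∅`.) -/
def Mcb {n m : ℕ} (a : Fin m → EuclideanSpace ℝ (Fin n)) (c : EuclideanSpace ℝ (Fin n))
    (b : Fin m → ℝ) : Set (Finset (Fin m)) :=
  {D | ∃ x ∈ Fop a c b, (D : Set (Fin m)) ⊆ activeSet a b x ∧ InCone a D (-c) ∧
    ∀ D' ⊆ D, InCone a D' (-c) → D' = D}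

/-- `M_c = {D ⊆ T : −c ∈ cone{a_t : t ∈ D} and D minimal w.r.t. inclusion}`. -/
def Mc {n m : ℕ} (a : Fin m → EuclideanSpace ℝ (Fin n)) (c : EuclideanSpace ℝ (Fin n)) :
    Set (Finset (Fin m)) :=
  {D | InCone a D (-c) ∧ ∀ D' ⊆ D, InCone a D' (-c) → D' = D}

/-- `S_D(b) = {x : ⟨a_t,x⟩ ≤ b_t for t ∈ T∖D, and ⟨a_t,x⟩ = b_t for t ∈ D}`. -/
def SD {n m : ℕ} (a : Fin m → EuclideanSpace ℝ (Fin n)) (D : Finset (Fin m))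
    (b : Fin m → ℝ) : Set (EuclideanSpace ℝ (Fin n)) :=
  {x | (∀ t ∉ D, ⟪a t, x⟫ ≤ b t) ∧ ∀ t ∈ D, ⟪a t, x⟫ = b t}

/-- A convex polyhedral subset: a finite intersection of closed half-spaces. -/
def IsPolyhedral {E : Type*} [NormedAddCommGroup E] [NormedSpace ℝ E] (C : Set E) : Prop :=
  ∃ (k : ℕ) (f : Fin k → E →L[ℝ] ℝ) (c : Fin k → ℝ), C = {x | ∀ i, f i x ≤ c i}

/-- `S = ⋃_{i ∈ I} S_i` is a well-connected polyhedral mapping: the graphs of the `S_i` are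
nonempty convex polyhedral sets, `dom S` is convex, and the restriction of `S` to each
`dom S_i` equals `S_i`. -/
structure IsWellConnectedPolyhedral {Y X I : Type*}
    [NormedAddCommGroup Y] [NormedSpace ℝ Y] [NormedAddCommGroup X] [NormedSpace ℝ X]
    [Finite I] (S : Y → Set X) (Si : I → Y → Set X) : Prop where
  graph_nonempty : ∀ i, {p : Y × X | p.2 ∈ Si i p.1}.Nonempty
  graph_polyhedral : ∀ i, IsPolyhedral {p : Y × X | p.2 ∈ Si i p.1}
  union : ∀ b, S b = ⋃ i, Si i b
  dom_convex : Convex ℝ {b | (S b).Nonempty}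
  restrict : ∀ i b, (Si i b).Nonempty → S b = Si i b

/-- **Carathéodory's theorem for cones**: a nonnegative combination of a finite family equals one
whose support is linearly independent. -/
theorem exists_linearIndepOn_nonneg_combination {ι E : Type*} [Fintype ι] [AddCommGroup E]
    [Module ℝ E] (v : ι → E) (lam : ι → ℝ) (hlam : ∀ i, 0 ≤ lam i) :
    ∃ (D : Finset ι) (mu : ι → ℝ), LinearIndependent ℝ (fun i : D => v i) ∧
      (∀ i, 0 ≤ mu i) ∧ (∀ i ∉ D, mu i = 0) ∧ ∑ i, mu i • v i = ∑ i, lam i • v i := by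
  classical
  let P : Finset ι → Prop := fun D => ∃ mu : ι → ℝ, (∀ i, 0 ≤ mu i) ∧ (∀ i ∉ D, mu i = 0) ∧
    ∑ i, mu i • v i = ∑ i, lam i • v i
  obtain ⟨D, ⟨mu, hmu, hmuD, hsum⟩, hmin⟩ := WellFounded.has_min
    (wellFounded_lt (α := Finset ι)) {D | P D} ⟨Finset.univ, lam, hlam, by simp, rfl⟩
  refine ⟨D, mu, ?_, hmu, hmuD, hsum⟩
  by_contra hdep
  obtain ⟨g, hgsum, i₀, hi₀⟩ := Fintype.not_linearIndependent_iff.1 hdep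
  obtain ⟨e, heD, hesum, j, hj⟩ : ∃ e : ι → ℝ, (∀ i ∉ D, e i = 0) ∧ ∑ i, e i • v i = 0 ∧
      ∃ j, 0 < e j := by
    let e : ι → ℝ := fun i => if h : i ∈ D then g ⟨i, h⟩ else 0
    have heD : ∀ i ∉ D, e i = 0 := fun i hi => dif_neg hi
    have he : ∀ i : D, e i = g i := fun i => dif_pos i.2
    have hesum : ∑ i, e i • v i = 0 := by
      rw [← Finset.sum_subset (Finset.subset_univ D) (fun i _ hi => by simp [heD i hi]),
        ← Finset.sum_coe_sort, ← hgsum]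
      exact Finset.sum_congr rfl fun i _ => by rw [he]
    rcases lt_or_gt_of_ne hi₀ with h | h
    · exact ⟨-e, fun i hi => by simp [heD i hi], by simp [hesum], i₀, by simpa [he] using h⟩
    · exact ⟨e, heD, hesum, i₀, by simpa [he] using h⟩
  obtain ⟨k, hk, hkmin⟩ := Finset.exists_min_image (Finset.univ.filter fun i => 0 < e i)
    (fun i => mu i / e i) ⟨j, by simpa using hj⟩
  have hek : 0 < e k := by simpa using hk
  have hkD : k ∈ D := by
    by_contra h
    exact hek.ne' (heD k h)
  refine hmin (D.erase k) ⟨fun i => mu i - mu k / e k * e i, fun i => ?_, fun i hi => ?_, ?_⟩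
    (Finset.erase_ssubset hkD)
  · rcases lt_or_ge 0 (e i) with h | h
    · have := (le_div_iff₀ h).1 (hkmin i (by simpa using h))
      linarith
    · have := mul_nonneg_of_nonpos_of_nonpos
        (neg_nonpos.2 (div_nonneg (hmu k) hek.le)) h
      linarith [hmu i]
  · rcases eq_or_ne i k with rfl | hik
    · field_simp
      ring
    · have hiD : i ∉ D := fun h => hi (Finset.mem_erase.2 ⟨hik, h⟩)
      simp [hmuD i hiD, heD i hiD]
  · simp only [sub_smul, mul_smul, Finset.sum_sub_distrib, ← Finset.smul_sum, hesum, hsum,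
      smul_zero, sub_zero]

/-- Finitely generated convex cones in a finite-dimensional space are closed. -/
theorem isClosed_image_linearCombination_Ici {ι E : Type*} [Fintype ι] [NormedAddCommGroup E]
    [NormedSpace ℝ E] (v : ι → E) :
    IsClosed (Fintype.linearCombination ℝ v '' Set.Ici 0) := by
  classical
  have key : Fintype.linearCombination ℝ v '' Set.Ici 0 =
      ⋃ D ∈ {D : Finset ι | LinearIndependent ℝ (fun i : D => v i)},
        Fintype.linearCombination ℝ (fun i : D => v i) '' Set.Ici 0 := by
    ext z
    simp only [Set.mem_iUnion, Set.mem_image, Set.mem_ofPred_eq, Set.mem_Ici,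
      Fintype.linearCombination_apply]
    constructor
    · rintro ⟨lam, hlam, rfl⟩
      obtain ⟨D, mu, hD, hmu, hmuD, hsum⟩ := exists_linearIndepOn_nonneg_combination v lam hlam
      refine ⟨D, hD, fun i => mu i, fun i => hmu i, ?_⟩
      rw [← hsum, ← Finset.sum_subset (Finset.subset_univ D)
        (fun i _ hi => by simp [hmuD i hi])]
      exact Finset.sum_coe_sort D (fun i => mu i • v i)
    · rintro ⟨D, -, lam, hlam, rfl⟩
      refine ⟨fun i => if h : i ∈ D then lam ⟨i, h⟩ else 0, fun i => ?_, ?_⟩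
      · dsimp only
        split_ifs with h
        exacts [hlam ⟨i, h⟩, le_rfl]
      · rw [← Finset.sum_subset (Finset.subset_univ D) (fun i _ hi => by simp [hi]),
          ← Finset.sum_coe_sort]
        exact Finset.sum_congr rfl fun i _ => by simp
  rw [key]
  refine (Set.toFinite _).isClosed_biUnion fun D hD => ?_
  exact (LinearMap.isClosedEmbedding_of_injective
    (LinearMap.ker_eq_bot.2 (LinearIndependent.fintypeLinearCombination_injective hD))).isClosedMap _
      isClosed_Ici

/-- **Farkas' lemma** for a finite system of affine inequalities. -/
theorem exists_forall_inner_le_or_exists_multipliers {ι E : Type*} [Fintype ι]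
    [NormedAddCommGroup E] [InnerProductSpace ℝ E] [CompleteSpace E] (g : ι → E) (β : ι → ℝ) :
    (∃ x, ∀ i, ⟪g i, x⟫ ≤ β i) ∨
      ∃ lam : ι → ℝ, (∀ i, 0 ≤ lam i) ∧ ∑ i, lam i • g i = 0 ∧ ∑ i, lam i * β i < 0 := by
  let w : Option ι → E × ℝ := fun o => o.elim (0, 1) fun i => (g i, β i)
  let C : ProperCone ℝ (E × ℝ) :=
    { (PointedCone.positive ℝ (Option ι → ℝ)).map (Fintype.linearCombination ℝ w) with
      isClosed' := by
        exact isClosed_image_linearCombination_Ici w }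
  have hmem : ∀ lam : Option ι → ℝ, 0 ≤ lam → Fintype.linearCombination ℝ w lam ∈ C :=
    fun lam hlam => ⟨lam, hlam, rfl⟩
  by_cases hC : ((0, -1) : E × ℝ) ∈ C
  · right
    obtain ⟨lam, hlam, h⟩ := hC
    have hlam : 0 ≤ lam := hlam
    have h : ∑ o, lam o • w o = (0, -1) := h
    rw [Fintype.sum_option] at h
    have h1 := congrArg Prod.fst h
    have h2 := congrArg Prod.snd h
    simp [w, Prod.fst_sum, Prod.snd_sum] at h1 h2
    exact ⟨fun i => lam (some i), fun i => hlam _, h1, by linarith [show 0 ≤ lam none from hlam _]⟩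
  · left
    classical
    obtain ⟨f, hf, hf0⟩ := C.hyperplane_separation_point hC
    have hfw : ∀ o, 0 ≤ f (w o) := fun o => by
      refine hf _ ?_
      simpa using hmem (Pi.single o 1) (by simp)
    let u : E := (InnerProductSpace.toDual ℝ E).symm (f.comp (ContinuousLinearMap.inl ℝ E ℝ))
    have hu : ∀ y s, f (y, s) = ⟪u, y⟫ + s * f (0, 1) := fun y s => by
      have h1 : ⟪u, y⟫ = f (y, 0) := by simp [u]
      rw [h1, ← smul_eq_mul, ← map_smul, ← map_add]
      simp
    have hk : 0 < f (0, 1) := by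
      rw [hu] at hf0
      simp only [inner_zero_right] at hf0
      linarith
    refine ⟨-((f (0, 1))⁻¹ • u), fun i => ?_⟩
    have h : 0 ≤ f (g i, β i) := hfw (some i)
    rw [hu] at h
    rw [inner_neg_right, inner_smul_right, real_inner_comm, neg_le, le_inv_mul_iff₀ hk]
    linarith

/-- A set cut out by finitely many half-spaces, indexed by any finite type, is polyhedral. -/
theorem isPolyhedral_of_finite {ι E : Type*} [Finite ι] [NormedAddCommGroup E] [NormedSpace ℝ E]
    (f : ι → E →L[ℝ] ℝ) (c : ι → ℝ) : IsPolyhedral {x | ∀ i, f i x ≤ c i} := by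
  obtain ⟨k, ⟨e⟩⟩ := Finite.exists_equiv_fin ι
  exact ⟨k, f ∘ e.symm, c ∘ e.symm, Set.ext fun x =>
    (e.symm.forall_congr_right (q := fun i => f i x ≤ c i)).symm⟩

section LinearProgram

variable {n m : ℕ} {a : Fin m → EuclideanSpace ℝ (Fin n)} {c : EuclideanSpace ℝ (Fin n)}
  {b : Fin m → ℝ} {D : Finset (Fin m)} {x : EuclideanSpace ℝ (Fin n)}

theorem inner_eq_of_neg_eq_sum {lam : Fin m → ℝ} (h : -c = ∑ t, lam t • a t)
    (y : EuclideanSpace ℝ (Fin n)) : ⟪c, y⟫ = -∑ t, lam t * ⟪a t, y⟫ := by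
  have := congrArg (fun z => ⟪z, y⟫) h
  simp only [inner_neg_left, sum_inner, real_inner_smul_left] at this
  linarith

theorem SD_subset_Feas : SD a D b ⊆ Feas a b := fun x hx t => by
  by_cases ht : t ∈ D
  exacts [(hx.2 t ht).le, hx.1 t ht]

theorem SD_subset_Fop (hD : InCone a D (-c)) : SD a D b ⊆ Fop a c b := by
  intro x hx
  refine ⟨SD_subset_Feas hx, fun y hy => ?_⟩
  obtain ⟨lam, hlam, hlamD, h⟩ := hD
  rw [inner_eq_of_neg_eq_sum h, inner_eq_of_neg_eq_sum h, neg_le_neg_iff]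
  refine Finset.sum_le_sum fun t _ => ?_
  by_cases ht : t ∈ D
  · rw [hx.2 t ht]
    exact mul_le_mul_of_nonneg_left (hy t) (hlam t)
  · simp [hlamD t ht]

/-- Multipliers attached to a minimal index set are positive on that set. -/
theorem pos_of_mem_Mc (hD : D ∈ Mc a c) {lam : Fin m → ℝ} (hlam : ∀ t, 0 ≤ lam t)
    (hlamD : ∀ t ∉ D, lam t = 0) (h : -c = ∑ t, lam t • a t) {t : Fin m} (ht : t ∈ D) :
    0 < lam t := by
  refine (hlam t).lt_of_ne fun h0 => ?_
  have := hD.2 (D.erase t) (Finset.erase_subset _ _) ⟨lam, hlam, fun s hs => ?_, h⟩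
  · exact Finset.erase_eq_self.1 this ht
  · rcases eq_or_ne s t with rfl | hst
    exacts [h0.symm, hlamD s fun hsD => hs (Finset.mem_erase.2 ⟨hst, hsD⟩)]

theorem Fop_eq_SD (hD : D ∈ Mc a c) (hne : (SD a D b).Nonempty) : Fop a c b = SD a D b := by
  refine Set.Subset.antisymm (fun y hy => ⟨fun t _ => hy.1 t, fun t ht => ?_⟩)
    (SD_subset_Fop hD.1)
  obtain ⟨x, hx⟩ := hne
  obtain ⟨lam, hlam, hlamD, h⟩ := hD.1
  have hle := hy.2 x (SD_subset_Feas hx)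
  rw [inner_eq_of_neg_eq_sum h, inner_eq_of_neg_eq_sum h, neg_le_neg_iff] at hle
  by_contra hne
  refine hle.not_gt (Finset.sum_lt_sum (fun s _ => ?_) ⟨t, Finset.mem_univ t, ?_⟩)
  · by_cases hs : s ∈ D
    · rw [hx.2 s hs]
      exact mul_le_mul_of_nonneg_left (hy.1 s) (hlam s)
    · simp [hlamD s hs]
  · rw [hx.2 t ht]
    exact mul_lt_mul_of_pos_left ((hy.1 t).lt_of_ne hne) (pos_of_mem_Mc hD hlam hlamD h ht)

theorem exists_subset_mem_Mc (hD : InCone a D (-c)) : ∃ D' ⊆ D, D' ∈ Mc a c := by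
  obtain ⟨D', hD', hmin⟩ := exists_minimal_le_of_wellFoundedLT (fun D => InCone a D (-c)) D hD
  exact ⟨D', hD', hmin.1, fun D'' hsub h => Finset.Subset.antisymm hsub (hmin.2 h hsub)⟩

/-- At an optimal point a direction that does not increase the active constraints is not a descent
direction. -/
theorem inner_nonneg_of_mem_Fop (hx : x ∈ Fop a c b) {y : EuclideanSpace ℝ (Fin n)}
    (hy : ∀ t, ⟪a t, x⟫ = b t → ⟪a t, y⟫ ≤ 0) : 0 ≤ ⟪c, y⟫ := by
  have hfeas : ∀ᶠ ε in nhdsWithin (0 : ℝ) (Set.Ioi 0), x + ε • y ∈ Feas a b := by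
    refine eventually_all.2 fun t => ?_
    rcases (hx.1 t).eq_or_lt with ht | ht
    · filter_upwards [self_mem_nhdsWithin] with ε hε
      rw [inner_add_right, inner_smul_right, ht]
      linarith [mul_nonneg_of_nonpos_of_nonpos (neg_nonpos.2 (le_of_lt hε)) (hy t ht)]
    · have hcont : Continuous fun ε : ℝ => ⟪a t, x + ε • y⟫ := by fun_prop
      refine nhdsWithin_le_nhds ?_
      filter_upwards [hcont.continuousAt.eventually_lt (continuousAt_const (y := b t))
        (by simpa using ht)] with ε hε using hε.le
  obtain ⟨ε, hε, hε0⟩ := (hfeas.and self_mem_nhdsWithin).exists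
  have := hx.2 _ hε
  rw [inner_add_right, inner_smul_right] at this
  exact nonneg_of_mul_nonneg_right (by linarith) hε0

/-- The **KKT conditions** hold at every optimal point. -/
theorem inCone_active_of_mem_Fop (hx : x ∈ Fop a c b) :
    InCone a (Finset.univ.filter fun t => ⟪a t, x⟫ = b t) (-c) := by
  let g : Option (Fin m) → EuclideanSpace ℝ (Fin n) :=
    fun o => o.elim c fun t => if ⟪a t, x⟫ = b t then a t else 0
  let β : Option (Fin m) → ℝ := fun o => o.elim (-1) fun _ => 0
  rcases exists_forall_inner_le_or_exists_multipliers g β with ⟨y, hy⟩ | ⟨lam, hlam, h1, h2⟩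
  · have hcy : ⟪c, y⟫ ≤ -1 := hy none
    have := inner_nonneg_of_mem_Fop hx (y := y) fun t ht => by simpa [g, β, ht] using hy (some t)
    linarith
  · rw [Fintype.sum_option] at h1 h2
    have hpos : 0 < lam none := by simpa [β] using h2
    refine ⟨fun t => if ⟪a t, x⟫ = b t then (lam none)⁻¹ * lam (some t) else 0,
      fun t => ?_, fun t ht => ?_, ?_⟩
    · dsimp only
      split_ifs
      exacts [mul_nonneg (inv_nonneg.2 hpos.le) (hlam _), le_rfl]
    · exact if_neg (by simpa using ht)
    · have h1 : lam none • c + ∑ t, lam (some t) • (if ⟪a t, x⟫ = b t then a t else 0) = 0 := h1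
      have h3 : -c = (lam none)⁻¹ • ∑ t, lam (some t) • (if ⟪a t, x⟫ = b t then a t else 0) := by
        rw [eq_neg_of_add_eq_zero_right h1, smul_neg, inv_smul_smul₀ hpos.ne']
      rw [h3, Finset.smul_sum]
      refine Finset.sum_congr rfl fun t _ => ?_
      by_cases ht : ⟪a t, x⟫ = b t <;> simp [ht, mul_smul]

theorem Fop_eq_iUnion_SD (a : Fin m → EuclideanSpace ℝ (Fin n)) (c : EuclideanSpace ℝ (Fin n))
    (b : Fin m → ℝ) : Fop a c b = ⋃ D ∈ Mc a c, SD a D b := by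
  refine Set.Subset.antisymm (fun x hx => ?_) (Set.iUnion₂_subset fun D hD => SD_subset_Fop hD.1)
  obtain ⟨D, hsub, hD⟩ := exists_subset_mem_Mc (inCone_active_of_mem_Fop hx)
  exact Set.mem_biUnion hD ⟨fun t _ => hx.1 t, fun t ht => by simpa using hsub ht⟩

/-- A feasible linear program with feasible dual attains its minimum. -/
theorem Fop_nonempty (hc : InCone a Finset.univ (-c)) (hb : (Feas a b).Nonempty) :
    (Fop a c b).Nonempty := by
  obtain ⟨lam₀, hlam₀, -, h₀⟩ := hc
  let V : Set ℝ := (fun y => ⟪c, y⟫) '' Feas a b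
  have hV : BddBelow V := by
    refine ⟨-∑ t, lam₀ t * b t, ?_⟩
    rintro _ ⟨y, hy, rfl⟩
    dsimp only
    rw [inner_eq_of_neg_eq_sum h₀, neg_le_neg_iff]
    exact Finset.sum_le_sum fun t _ => mul_le_mul_of_nonneg_left (hy t) (hlam₀ t)
  let g : Option (Fin m) → EuclideanSpace ℝ (Fin n) := fun o => o.elim c a
  let β : Option (Fin m) → ℝ := fun o => o.elim (sInf V) b
  rcases exists_forall_inner_le_or_exists_multipliers g β with ⟨x, hx⟩ | ⟨lam, hlam, h1, h2⟩
  · exact ⟨x, fun t => hx (some t), fun y hy =>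
      (hx none).trans (csInf_le hV (Set.mem_image_of_mem _ hy))⟩
  · exfalso
    rw [Fintype.sum_option] at h1 h2
    have h1 : lam none • c + ∑ t, lam (some t) • a t = 0 := h1
    have h2 : lam none * sInf V + ∑ t, lam (some t) * b t < 0 := h2
    have key : ∀ y ∈ Feas a b, -∑ t, lam (some t) * b t ≤ lam none * ⟪c, y⟫ := fun y hy => by
      have h3 := congrArg (fun z => ⟪z, y⟫) h1
      simp only [inner_add_left, sum_inner, real_inner_smul_left, inner_zero_left] at h3
      have h4 : ∑ t, lam (some t) * ⟪a t, y⟫ ≤ ∑ t, lam (some t) * b t :=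
        Finset.sum_le_sum fun t _ => mul_le_mul_of_nonneg_left (hy t) (hlam _)
      linarith
    obtain ⟨y₀, hy₀⟩ := hb
    have hpos : 0 < lam none := (hlam none).lt_of_ne fun h => by
      have := key y₀ hy₀
      rw [← h, zero_mul] at this h2
      linarith
    have hle : (lam none)⁻¹ * -∑ t, lam (some t) * b t ≤ sInf V := by
      refine le_csInf ⟨_, Set.mem_image_of_mem _ hy₀⟩ ?_
      rintro _ ⟨y, hy, rfl⟩
      exact (inv_mul_le_iff₀ hpos).2 (key y hy)
    rw [inv_mul_le_iff₀ hpos] at hle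
    linarith

theorem convex_setOf_Fop_nonempty (hc : InCone a Finset.univ (-c)) :
    Convex ℝ {b | (Fop a c b).Nonempty} := by
  rintro b₁ ⟨x₁, hx₁⟩ b₂ ⟨x₂, hx₂⟩ p q hp hq -
  refine Fop_nonempty hc ⟨p • x₁ + q • x₂, fun t => ?_⟩
  rw [inner_add_right, inner_smul_right, inner_smul_right]
  exact add_le_add (mul_le_mul_of_nonneg_left (hx₁.1 t) hp)
    (mul_le_mul_of_nonneg_left (hx₂.1 t) hq)

theorem isPolyhedral_graph_SD (a : Fin m → EuclideanSpace ℝ (Fin n)) (D : Finset (Fin m)) :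
    IsPolyhedral {p : (Fin m → ℝ) × EuclideanSpace ℝ (Fin n) | p.2 ∈ SD a D p.1} := by
  let r : Fin m → ((Fin m → ℝ) × EuclideanSpace ℝ (Fin n)) →L[ℝ] ℝ := fun t =>
    (innerSL ℝ (a t)).comp (ContinuousLinearMap.snd ℝ _ _) -
      (ContinuousLinearMap.proj (R := ℝ) (φ := fun _ : Fin m => ℝ) t).comp (ContinuousLinearMap.fst ℝ _ _)
  have hr : ∀ t p, r t p = ⟪a t, p.2⟫ - p.1 t := fun t p => by simp [r]
  convert isPolyhedral_of_finite (Sum.elim r fun t : D => -r t) 0 using 1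
  ext p
  simp only [Set.mem_ofPred_eq, Sum.forall, Sum.elim_inl, Sum.elim_inr, Pi.zero_apply,
    neg_apply, hr, Subtype.forall]
  constructor
  · intro h
    exact ⟨fun t => by linarith [SD_subset_Feas h t], fun t ht => by linarith [h.2 t ht]⟩
  · rintro ⟨h1, h2⟩
    exact ⟨fun t _ => by linarith [h1 t], fun t ht => by linarith [h1 t, h2 t ht]⟩

end LinearProgram

/-- Assume `−c̄ ∈ cone{a_t : t ∈ T}`. Then:
(i) `F_c̄^op(b) = ⋃_{D ∈ M_c̄} S_D(b)` for all `b`;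
(ii) `F_c̄^op(b) = S_D(b)` for every `D ∈ M_c̄` and every `b ∈ dom S_D`.
Consequently, `F_c̄^op = ⋃_{D ∈ M_c̄} S_D` is a well-connected polyhedral mapping. -/
theorem Fop_wellConnected {n m : ℕ} (a : Fin m → EuclideanSpace ℝ (Fin n))
    (cbar : EuclideanSpace ℝ (Fin n)) (hc : InCone a Finset.univ (-cbar)) :
    (∀ b, Fop a cbar b = ⋃ D ∈ Mc a cbar, SD a D b) ∧
    (∀ D ∈ Mc a cbar, ∀ b, (SD a D b).Nonempty → Fop a cbar b = SD a D b) ∧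
    IsWellConnectedPolyhedral (fun b => Fop a cbar b)
      (fun D : ↥(Mc a cbar) => SD a D.1) := by
  refine ⟨Fop_eq_iUnion_SD a cbar, fun D hD b => Fop_eq_SD hD, ?_⟩
  exact
    { graph_nonempty := fun D => ⟨0, by simp [SD]⟩
      graph_polyhedral := fun D => isPolyhedral_graph_SD a D.1
      union := fun b => by rw [Fop_eq_iUnion_SD, Set.biUnion_eq_iUnion]
      dom_convex := convex_setOf_Fop_nonempty hc
      restrict := fun D b => Fop_eq_SD D.2 }
end

section
/- Let b̄, b ∈ dom F and assume M_{c̄,b̄} = M_{c̄,b} ≠ ∅. Then M_{c̄, b̄ + μ(b − b̄)} = M_{c̄,b̄} for all μ ∈ [0,1]. -/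
open scoped ENNReal RealInnerProductSpace
open Filter EMetric Set

theorem inner_eq_neg_sum_of_neg_eq_sum {n m : ℕ} {a : Fin m → EuclideanSpace ℝ (Fin n)}
    {c : EuclideanSpace ℝ (Fin n)} {lam : Fin m → ℝ} (h : -c = ∑ t, lam t • a t)
    (x : EuclideanSpace ℝ (Fin n)) : ⟪c, x⟫ = -∑ t, lam t * ⟪a t, x⟫ := by
  have hc : ⟪-c, x⟫ = ∑ t, lam t * ⟪a t, x⟫ := by
    rw [h, sum_inner]
    simp only [real_inner_smul_left]
  rw [inner_neg_left] at hc
  linarith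

/-- Sufficiency of the KKT conditions in linear programming. -/
theorem mem_Fop_of_inCone {n m : ℕ} {a : Fin m → EuclideanSpace ℝ (Fin n)}
    {c : EuclideanSpace ℝ (Fin n)} {b : Fin m → ℝ} {x : EuclideanSpace ℝ (Fin n)}
    {D : Finset (Fin m)} (hx : x ∈ Feas a b) (hD : (D : Set (Fin m)) ⊆ activeSet a b x)
    (hcone : InCone a D (-c)) : x ∈ Fop a c b := by
  obtain ⟨lam, hpos, hzero, hsum⟩ := hcone
  refine ⟨hx, fun y hy => ?_⟩
  rw [inner_eq_neg_sum_of_neg_eq_sum hsum, inner_eq_neg_sum_of_neg_eq_sum hsum]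
  refine neg_le_neg (Finset.sum_le_sum fun t _ => ?_)
  by_cases ht : t ∈ D
  · have hact : ⟪a t, x⟫ = b t := hD ht
    rw [hact]
    exact mul_le_mul_of_nonneg_left (hy t) (hpos t)
  · simp [hzero t ht]

/-- A minimal KKT index set is active at every optimal point. -/
theorem subset_activeSet_of_mem_Mcb {n m : ℕ} {a : Fin m → EuclideanSpace ℝ (Fin n)}
    {c : EuclideanSpace ℝ (Fin n)} {b : Fin m → ℝ} {x : EuclideanSpace ℝ (Fin n)}
    {D : Finset (Fin m)} (hD : D ∈ Mcb a c b) (hx : x ∈ Fop a c b) :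
    (D : Set (Fin m)) ⊆ activeSet a b x := by
  obtain ⟨y, hy, hact, ⟨lam, hpos, hzero, hsum⟩, hmin⟩ := hD
  have hval : ∑ t, lam t * ⟪a t, x⟫ = ∑ t, lam t * ⟪a t, y⟫ := by
    have h : ⟪c, x⟫ = ⟪c, y⟫ := le_antisymm (hx.2 y hy.1) (hy.2 x hx.1)
    rw [inner_eq_neg_sum_of_neg_eq_sum hsum, inner_eq_neg_sum_of_neg_eq_sum hsum] at h
    exact neg_injective h
  have hle : ∀ t ∈ Finset.univ, lam t * ⟪a t, x⟫ ≤ lam t * ⟪a t, y⟫ := by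
    intro t _
    by_cases ht : t ∈ D
    · have h : ⟪a t, y⟫ = b t := hact ht
      rw [h]
      exact mul_le_mul_of_nonneg_left (hx.1 t) (hpos t)
    · simp [hzero t ht]
  intro t ht
  have hne : lam t ≠ 0 := by
    intro h0
    have hcone : InCone a (D.erase t) (-c) := by
      refine ⟨lam, hpos, fun s hs => ?_, hsum⟩
      by_cases hst : s = t
      · rw [hst, h0]
      · exact hzero s fun hsD => hs (Finset.mem_erase.2 ⟨hst, hsD⟩)
    exact Finset.erase_eq_self.1 (hmin _ (Finset.erase_subset t D) hcone) ht
  have hterm := (Finset.sum_eq_sum_iff_of_le hle).1 hval t (Finset.mem_univ t)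
  exact (mul_left_cancel₀ hne hterm).trans (hact ht)

/-- Let `b̄, b ∈ dom F` and assume `M_{c̄,b̄} = M_{c̄,b} ≠ ∅`. Then
`M_{c̄, b̄+μ(b−b̄)} = M_{c̄,b̄}` for all `μ ∈ [0,1]`. -/
theorem Mcb_constant_on_segment {n m : ℕ} (a : Fin m → EuclideanSpace ℝ (Fin n))
    (cbar : EuclideanSpace ℝ (Fin n)) (bbar b : Fin m → ℝ)
    (hbbar : (Feas a bbar).Nonempty) (hb : (Feas a b).Nonempty)
    (heq : Mcb a cbar bbar = Mcb a cbar b) (hne : (Mcb a cbar bbar).Nonempty) :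
    ∀ μ ∈ Set.Icc (0 : ℝ) 1, Mcb a cbar (bbar + μ • (b - bbar)) = Mcb a cbar bbar := by
  rintro μ ⟨h0, h1⟩
  rcases h0.eq_or_lt with rfl | h0
  · simp
  rcases h1.eq_or_lt with rfl | h1
  · simp [heq]
  obtain ⟨D₀, hD₀⟩ := hne
  have ⟨xbar, hxbar, _, hcone, _⟩ := hD₀
  obtain ⟨x, hx, -⟩ := heq ▸ hD₀
  have hinner : ∀ t, ⟪a t, xbar + μ • (x - xbar)⟫ = (1 - μ) * ⟪a t, xbar⟫ + μ * ⟪a t, x⟫ := by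
    intro t
    rw [inner_add_right, real_inner_smul_right, inner_sub_right]
    ring
  have hrhs : ∀ t, (bbar + μ • (b - bbar)) t = (1 - μ) * bbar t + μ * b t := by
    intro t
    simp only [Pi.add_apply, Pi.smul_apply, Pi.sub_apply, smul_eq_mul]
    ring
  have hfeas : xbar + μ • (x - xbar) ∈ Feas a (bbar + μ • (b - bbar)) := by
    intro t
    rw [hinner, hrhs]
    exact add_le_add (mul_le_mul_of_nonneg_left (hxbar.1 t) (sub_pos.2 h1).le)
      (mul_le_mul_of_nonneg_left (hx.1 t) h0.le)
  have hactive : ∀ D ∈ Mcb a cbar bbar,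
      (D : Set (Fin m)) ⊆ activeSet a (bbar + μ • (b - bbar)) (xbar + μ • (x - xbar)) := by
    intro D hD t ht
    have hbar : ⟪a t, xbar⟫ = bbar t := subset_activeSet_of_mem_Mcb hD hxbar ht
    have hend : ⟪a t, x⟫ = b t := subset_activeSet_of_mem_Mcb (heq ▸ hD) hx ht
    change ⟪a t, _⟫ = _
    rw [hinner, hrhs, hbar, hend]
  have hopt : xbar + μ • (x - xbar) ∈ Fop a cbar (bbar + μ • (b - bbar)) :=
    mem_Fop_of_inCone hfeas (hactive D₀ hD₀) hcone
  ext D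
  constructor
  · intro hD
    have hact := subset_activeSet_of_mem_Mcb hD hopt
    obtain ⟨-, -, -, hkkt⟩ := hD
    refine ⟨xbar, hxbar, fun t ht => ?_, hkkt⟩
    have h : ⟪a t, xbar + μ • (x - xbar)⟫ = (bbar + μ • (b - bbar)) t := hact ht
    rw [hinner, hrhs] at h
    have hle := mul_le_mul_of_nonneg_left (hx.1 t) h0.le
    have hge : (1 - μ) * bbar t ≤ (1 - μ) * ⟪a t, xbar⟫ := by linarith
    exact le_antisymm (hxbar.1 t) (le_of_mul_le_mul_left hge (sub_pos.2 h1))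
  · intro hD
    have hact := hactive D hD
    obtain ⟨-, -, -, hkkt⟩ := hD
    exact ⟨_, hopt, hact, hkkt⟩
end

section
/- Assume −c̄ ∈ cone{a_t : t ∈ T}. Let b̄, b ∈ dom F with b̄ ≠ b, write B(b̄,b) = {μ_1, …, μ_N} with 0 := μ_0 < μ_1 < … < μ_N < μ_{N+1} := 1, and for each i = 1,…,N+1 fix any D_i ∈ M_{c̄, b̄ + μ(b − b̄)} for μ ∈ (μ_{i-1},μ_i) (this family is constant on the interval). Then D_1,…,D_{N+1} ∈ M_c̄, and the subdivision 0 = μ_0 < μ_1 < … < μ_N < μ_{N+1} = 1 together with the family D_1,…,D_{N+1} connects b with b̄ for the mapping F_c̄^op = ⋃_{D ∈ M_c̄} S_D; i.e. for all i ∈ {1,…,N+1} and all μ ∈ [μ_{i-1},μ_i], b̄ + μ(b − b̄) ∈ dom S_{D_i}. -/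
open scoped ENNReal RealInnerProductSpace
open Filter EMetric Set

/-- The break step set `B(b̄,b)`: points `μ ∈ (0,1)` approachable by a sequence `ν_r → μ`
with `M_{c,b̄+ν_r(b−b̄)} ⊊ M_{c,b̄+μ(b−b̄)}` for all `r`. -/
def BreakSet {n m : ℕ} (a : Fin m → EuclideanSpace ℝ (Fin n)) (c : EuclideanSpace ℝ (Fin n))
    (bbar b : Fin m → ℝ) : Set ℝ :=
  {μ ∈ Set.Ioo (0 : ℝ) 1 | ∃ ν : ℕ → ℝ, Tendsto ν atTop (nhds μ) ∧
    ∀ r : ℕ, Mcb a c (bbar + ν r • (b - bbar)) ⊂ Mcb a c (bbar + μ • (b - bbar))}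

open Module in
/-- The image under a linear map of a polyhedral cone (inside a subspace) is closed. -/
theorem isClosed_image_polyhedralCone {ι E F : Type*} [Finite ι]
    [AddCommGroup E] [Module ℝ E] [TopologicalSpace E] [IsTopologicalAddGroup E]
    [ContinuousSMul ℝ E] [T2Space E] [FiniteDimensional ℝ E]
    [AddCommGroup F] [Module ℝ F] [TopologicalSpace F] [IsTopologicalAddGroup F]
    [ContinuousSMul ℝ F] [T2Space F]
    (f : E →ₗ[ℝ] F) (g : ι → E →ₗ[ℝ] ℝ) (W : Submodule ℝ E) :
    IsClosed (f '' {v | v ∈ W ∧ ∀ i, 0 ≤ g i v}) := by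
  induction h : finrank ℝ W using Nat.strong_induction_on generalizing W with
  | _ d ih =>
  have ih_ker (φ : E →ₗ[ℝ] ℝ) (k : E) (hkW : k ∈ W) (hφ : φ k ≠ 0) :
      IsClosed (f '' {v | v ∈ W ⊓ LinearMap.ker φ ∧ ∀ i, 0 ≤ g i v}) := by
    refine ih _ ?_ _ rfl
    rw [← h]
    refine Submodule.finrank_lt_finrank_of_lt (lt_of_le_of_ne inf_le_left fun heq => hφ ?_)
    exact (heq.ge hkW).2
  by_cases hinj : Function.Injective (f.domRestrict W)
  · have hset : f '' {v | v ∈ W ∧ ∀ i, 0 ≤ g i v} =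
        f.domRestrict W '' {w | ∀ i, 0 ≤ g i w} := by
      ext y
      constructor
      · rintro ⟨v, ⟨hv, hg⟩, rfl⟩
        exact ⟨⟨v, hv⟩, hg, rfl⟩
      · rintro ⟨w, hg, rfl⟩
        exact ⟨w, ⟨w.2, hg⟩, rfl⟩
    rw [hset]
    refine (LinearMap.isClosedEmbedding_of_injective
      (LinearMap.ker_eq_bot.2 hinj)).isClosedMap _ ?_
    simp only [ofPred_forall]
    exact isClosed_iInter fun i => isClosed_le continuous_const
      ((g i).continuous_of_finiteDimensional.comp continuous_subtype_val)
  obtain ⟨k, hkW, hk0, hfk⟩ : ∃ k ∈ W, k ≠ 0 ∧ f k = 0 := by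
    rw [← LinearMap.ker_eq_bot, Submodule.eq_bot_iff] at hinj
    push Not at hinj
    obtain ⟨w, hw, hw0⟩ := hinj
    exact ⟨w, w.2, by simpa using hw0, by simpa using hw⟩
  by_cases hall : ∀ i, g i k = 0
  · obtain ⟨φ, hφ⟩ : ∃ φ : Dual ℝ E, φ k ≠ 0 := by
      by_contra! hφ
      exact hk0 ((forall_dual_apply_eq_zero_iff ℝ k).1 hφ)
    convert ih_ker φ k hkW hφ using 1
    refine Subset.antisymm ?_ (image_mono fun v hv => ⟨hv.1.1, hv.2⟩)
    rintro _ ⟨v, ⟨hv, hg⟩, rfl⟩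
    refine ⟨v - (φ v / φ k) • k, ⟨⟨W.sub_mem hv (W.smul_mem _ hkW), ?_⟩, fun i => ?_⟩, ?_⟩
    · simp [hφ]
    · simpa [hall i] using hg i
    · simp [hfk]
  obtain ⟨k, hkW, hfk, i₀, hi₀⟩ : ∃ k ∈ W, f k = 0 ∧ ∃ i, g i k < 0 := by
    push Not at hall
    obtain ⟨i, hi⟩ := hall
    rcases hi.lt_or_gt with hi | hi
    · exact ⟨k, hkW, hfk, i, hi⟩
    · exact ⟨-k, W.neg_mem hkW, by simp [hfk], i, by simpa using hi⟩
  have hset : f '' {v | v ∈ W ∧ ∀ i, 0 ≤ g i v} =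
      ⋃ j ∈ {j | g j k < 0}, f '' {v | v ∈ W ⊓ LinearMap.ker (g j) ∧ ∀ i, 0 ≤ g i v} := by
    refine Subset.antisymm ?_ (iUnion₂_subset fun j _ => image_mono fun v hv => ⟨hv.1.1, hv.2⟩)
    rintro _ ⟨v, ⟨hv, hg⟩, rfl⟩
    obtain ⟨j, hj, hmin⟩ := exists_min_image {j | g j k < 0} (fun j => g j v / -g j k)
      (toFinite _) ⟨i₀, hi₀⟩
    have hj : g j k < 0 := hj
    have ht : 0 ≤ g j v / -g j k := div_nonneg (hg j) (by linarith)
    refine mem_iUnion₂.2 ⟨j, hj, v + (g j v / -g j k) • k,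
      ⟨⟨W.add_mem hv (W.smul_mem _ hkW), ?_⟩, fun i => ?_⟩, by simp [hfk]⟩
    · have := hj.ne
      simp only [SetLike.mem_coe, LinearMap.mem_ker, map_add, map_smul, smul_eq_mul]
      field_simp
      ring
    · simp only [map_add, map_smul, smul_eq_mul]
      rcases lt_or_ge (g i k) 0 with hi | hi
      · have := hmin i hi
        rw [le_div_iff₀ (by linarith)] at this
        linarith
      · have := hg i
        positivity
  rw [hset]
  exact (toFinite _).isClosed_biUnion fun j hj => ih_ker (g j) k hkW (ne_of_lt hj)

theorem isClosed_setOf_SD_nonempty {n m : ℕ} (a : Fin m → EuclideanSpace ℝ (Fin n))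
    (D : Finset (Fin m)) : IsClosed {b : Fin m → ℝ | (SD a D b).Nonempty} := by
  let slack (t : Fin m) : EuclideanSpace ℝ (Fin n) × (Fin m → ℝ) →ₗ[ℝ] ℝ :=
    LinearMap.proj (R := ℝ) (φ := fun _ => ℝ) t ∘ₗ LinearMap.snd ℝ _ _ - innerₗ _ (a t) ∘ₗ LinearMap.fst ℝ _ _
  let g : Fin m ⊕ D → EuclideanSpace ℝ (Fin n) × (Fin m → ℝ) →ₗ[ℝ] ℝ :=
    Sum.elim slack fun t => -slack t
  convert isClosed_image_polyhedralCone (LinearMap.snd ℝ _ _) g ⊤ using 1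
  ext b
  constructor
  · rintro ⟨x, hle, heq⟩
    refine ⟨(x, b), ⟨trivial, ?_⟩, rfl⟩
    rintro (t | ⟨t, ht⟩)
    · by_cases ht : t ∈ D
      · simp [g, slack, heq t ht]
      · simpa [g, slack] using hle t ht
    · simp [g, slack, heq t ht]
  · rintro ⟨⟨x, b'⟩, ⟨-, hg⟩, rfl⟩
    have hle (t : Fin m) : ⟪a t, x⟫ ≤ b' t := by simpa [g, slack] using hg (.inl t)
    refine ⟨x, fun t _ => hle t, fun t ht => (hle t).antisymm ?_⟩
    simpa [g, slack] using hg (.inr ⟨t, ht⟩)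

theorem mem_Mc_of_mem_Mcb {n m : ℕ} {a : Fin m → EuclideanSpace ℝ (Fin n)}
    {c : EuclideanSpace ℝ (Fin n)} {b : Fin m → ℝ} {D : Finset (Fin m)}
    (h : D ∈ Mcb a c b) : D ∈ Mc a c := by
  obtain ⟨_, _, _, hmin⟩ := h
  exact hmin

theorem SD_nonempty_of_mem_Mcb {n m : ℕ} {a : Fin m → EuclideanSpace ℝ (Fin n)}
    {c : EuclideanSpace ℝ (Fin n)} {b : Fin m → ℝ} {D : Finset (Fin m)}
    (h : D ∈ Mcb a c b) : (SD a D b).Nonempty := by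
  obtain ⟨x, hx, hact, _⟩ := h
  exact ⟨x, fun t _ => hx.1 t, fun t ht => hact ht⟩

/-- Assume `−c̄ ∈ cone{a_t : t ∈ T}`. Let `b̄, b ∈ dom F`, `b̄ ≠ b`, write
`B(b̄,b) = {μ_1,…,μ_N}` with `0 := μ_0 < μ_1 < … < μ_N < μ_{N+1} := 1`, and for each
`i = 1,…,N+1` fix `D_i ∈ M_{c̄, b̄+μ(b−b̄)}` for all `μ ∈ (μ_{i−1},μ_i)`. Then
`D_1,…,D_{N+1} ∈ M_c̄` and the subdivision together with `D_1,…,D_{N+1}` connects `b` with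
`b̄` for `F_c̄^op = ⋃_{D ∈ M_c̄} S_D`: for all `i` and all `μ ∈ [μ_{i−1},μ_i]`,
`b̄ + μ(b−b̄) ∈ dom S_{D_i}`. -/
theorem break_steps_connect {n m : ℕ} (a : Fin m → EuclideanSpace ℝ (Fin n))
    (cbar : EuclideanSpace ℝ (Fin n)) (hc : InCone a Finset.univ (-cbar))
    (bbar b : Fin m → ℝ)
    (hbbar : (Feas a bbar).Nonempty) (hb : (Feas a b).Nonempty) (hne : bbar ≠ b)
    (N : ℕ) (μ : ℕ → ℝ) (hμ0 : μ 0 = 0) (hμlast : μ (N + 1) = 1)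
    (hmono : ∀ i ≤ N, μ i < μ (i + 1))
    (henum : BreakSet a cbar bbar b = μ '' {i : ℕ | 1 ≤ i ∧ i ≤ N})
    (D : ℕ → Finset (Fin m))
    (hD : ∀ i, 1 ≤ i → i ≤ N + 1 → ∀ s ∈ Set.Ioo (μ (i - 1)) (μ i),
      D i ∈ Mcb a cbar (bbar + s • (b - bbar))) :
    (∀ i, 1 ≤ i → i ≤ N + 1 → D i ∈ Mc a cbar) ∧
    (∀ i, 1 ≤ i → i ≤ N + 1 → ∀ s ∈ Set.Icc (μ (i - 1)) (μ i),
      (SD a (D i) (bbar + s • (b - bbar))).Nonempty) := by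
  have hlt (i : ℕ) (h1 : 1 ≤ i) (hN : i ≤ N + 1) : μ (i - 1) < μ i := by
    simpa [Nat.sub_add_cancel h1] using hmono (i - 1) (by lia)
  refine ⟨fun i h1 hN => ?_, fun i h1 hN => ?_⟩
  · obtain ⟨s, hs⟩ := exists_between (hlt i h1 hN)
    exact mem_Mc_of_mem_Mcb (hD i h1 hN s hs)
  · have hclosed : IsClosed {s : ℝ | (SD a (D i) (bbar + s • (b - bbar))).Nonempty} :=
      (isClosed_setOf_SD_nonempty a (D i)).preimage
        (f := fun s : ℝ => bbar + s • (b - bbar)) (by fun_prop)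
    rw [← closure_Ioo (hlt i h1 hN).ne]
    exact closure_minimal (fun s hs => SD_nonempty_of_mem_Mcb (hD i h1 hN s hs)) hclosed
end

section
/- Let b̄, b ∈ ℝ^m, x̄ ∈ F(b̄) and x ∈ F(b), and for μ ∈ (0,1) set (b^μ, x^μ) := (b̄, x̄) + μ(b − b̄, x − x̄). Then x^μ ∈ F(b^μ) and T_{b^μ}(x^μ) = T_b̄(x̄) ∩ T_b(x) for all μ ∈ (0,1). -/
open scoped ENNReal RealInnerProductSpace
open Filter EMetric Set

/-- Let `b̄, b ∈ ℝᵐ`, `x̄ ∈ F(b̄)` and `x ∈ F(b)`, and for `μ ∈ (0,1)` set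
`(b^μ, x^μ) := (b̄,x̄) + μ(b − b̄, x − x̄)`. Then `x^μ ∈ F(b^μ)` and
`T_{b^μ}(x^μ) = T_b̄(x̄) ∩ T_b(x)` for all `μ ∈ (0,1)`. -/
theorem active_set_of_convex_combination {n m : ℕ} (a : Fin m → EuclideanSpace ℝ (Fin n))
    (bbar b : Fin m → ℝ) (xbar x : EuclideanSpace ℝ (Fin n))
    (hxbar : xbar ∈ Feas a bbar) (hx : x ∈ Feas a b) :
    ∀ μ ∈ Set.Ioo (0 : ℝ) 1,
      xbar + μ • (x - xbar) ∈ Feas a (bbar + μ • (b - bbar)) ∧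
      activeSet a (bbar + μ • (b - bbar)) (xbar + μ • (x - xbar))
        = activeSet a bbar xbar ∩ activeSet a b x := by
  rintro μ ⟨hμ0, hμ1⟩
  have slack : ∀ t, (bbar + μ • (b - bbar)) t - ⟪a t, xbar + μ • (x - xbar)⟫ =
      (1 - μ) * (bbar t - ⟪a t, xbar⟫) + μ * (b t - ⟪a t, x⟫) := fun t => by
    simp only [Pi.add_apply, Pi.smul_apply, Pi.sub_apply, smul_eq_mul, inner_add_right,
      inner_smul_right, inner_sub_right]
    ring
  have slack_bar_nonneg : ∀ t, 0 ≤ (1 - μ) * (bbar t - ⟪a t, xbar⟫) := fun t =>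
    mul_nonneg (sub_nonneg.2 hμ1.le) (sub_nonneg.2 (hxbar t))
  have slack_nonneg : ∀ t, 0 ≤ μ * (b t - ⟪a t, x⟫) := fun t =>
    mul_nonneg hμ0.le (sub_nonneg.2 (hx t))
  refine ⟨fun t => ?_, Set.ext fun t => ?_⟩
  · rw [← sub_nonneg, slack]
    exact add_nonneg (slack_bar_nonneg t) (slack_nonneg t)
  · simp only [activeSet, Set.mem_inter_iff, Set.mem_ofPred_eq]
    rw [eq_comm, ← sub_eq_zero, slack,
      add_eq_zero_iff_of_nonneg (slack_bar_nonneg t) (slack_nonneg t),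
      mul_eq_zero_iff_left (sub_pos.2 hμ1).ne', mul_eq_zero_iff_left hμ0.ne',
      sub_eq_zero, sub_eq_zero, eq_comm, @eq_comm _ (b t)]
end
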